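/- The progression angle satisfies lim_{C₂ → +∞} Λ^Θ(C₂) = π. -/

import Mathlib

open Filter

/-- The complete elliptic integral of the third kind
`Π(n, m) = ∫₀^{π/2} dθ / ((1 - n sin²θ)·√(1 - m sin²θ))`. -/
noncomputable def ellipticPi (n m : ℝ) : ℝ :=
  ∫ θ in (0 : ℝ)..(Real.pi / 2),
    1 / ((1 - n * Real.sin θ ^ 2) * Real.sqrt (1 - m * Real.sin θ ^ 2))

section

open MeasureTheory intervalIntegral

lemma hasDerivAt_arctan_primitive {k : ℝ} (hk : 0 < k) (θ : ℝ) :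
    HasDerivAt (fun θ => (θ + Real.arctan ((k - 1) * (Real.sin θ * Real.cos θ) /
      (Real.cos θ ^ 2 + k * Real.sin θ ^ 2))) / k)
      (1 / (1 + (k ^ 2 - 1) * Real.sin θ ^ 2)) θ := by
  have hsc := Real.sin_sq_add_cos_sq θ
  have hs := Real.hasDerivAt_sin θ
  have hc := Real.hasDerivAt_cos θ
  set s := Real.sin θ with hs_def
  set c := Real.cos θ with hc_def
  have pos (x : ℝ) (hx : 0 < x) : 0 < c ^ 2 + x * s ^ 2 := by
    rcases eq_or_ne s 0 with h | h
    · rw [h] at hsc ⊢; nlinarith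
    · have := mul_pos hx (sq_pos_of_ne_zero h)
      nlinarith [sq_nonneg c]
  have hD := pos k hk
  have hE := pos (k ^ 2) (by positivity)
  have hden : 1 + (k ^ 2 - 1) * s ^ 2 = c ^ 2 + k ^ 2 * s ^ 2 := by linear_combination -hsc
  have hfactor : (c ^ 2 + k * s ^ 2) ^ 2 + ((k - 1) * (s * c)) ^ 2 = c ^ 2 + k ^ 2 * s ^ 2 := by
    linear_combination (c ^ 2 + k ^ 2 * s ^ 2) * hsc
  have hd := (((hasDerivAt_id θ).add ((((hs.mul hc).const_mul (k - 1)).div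
    ((hc.pow 2).add ((hs.pow 2).const_mul k)) hD.ne').arctan)).div_const k)
  refine hd.congr_deriv ?_
  simp only [Pi.mul_apply, Pi.div_apply, Pi.add_apply, Pi.pow_apply, ← hs_def, ← hc_def]
  have hu : 1 + ((k - 1) * (s * c) / (c ^ 2 + k * s ^ 2)) ^ 2 =
      (c ^ 2 + k ^ 2 * s ^ 2) / (c ^ 2 + k * s ^ 2) ^ 2 := by
    rw [← hfactor]; field_simp
  rw [hu, hden]
  field_simp
  have hc2 : c ^ 2 = 1 - s ^ 2 := by linarith
  ring_nf
  simp only [show c ^ 4 = (c ^ 2) ^ 2 by ring, hc2]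
  ring

lemma continuous_one_div_one_add_mul_sin_sq {N : ℝ} (hN : 0 ≤ N) :
    Continuous fun θ : ℝ => 1 / (1 + N * Real.sin θ ^ 2) :=
  Continuous.div (by fun_prop) (by fun_prop) fun θ => by positivity

lemma integral_one_div_one_add_mul_sin_sq {N : ℝ} (hN : 0 ≤ N) :
    ∫ θ in (0 : ℝ)..(Real.pi / 2), 1 / (1 + N * Real.sin θ ^ 2) =
      Real.pi / (2 * Real.sqrt (1 + N)) := by
  have hk : 0 < Real.sqrt (1 + N) := by positivity
  have hsq : Real.sqrt (1 + N) ^ 2 - 1 = N := by rw [Real.sq_sqrt (by positivity)]; ring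
  have hderiv := fun θ : ℝ => hasDerivAt_arctan_primitive hk θ
  simp only [hsq] at hderiv
  rw [integral_eq_sub_of_hasDerivAt (fun θ _ => hderiv θ)
    ((continuous_one_div_one_add_mul_sin_sq hN).intervalIntegrable _ _)]
  simp
  field_simp

lemma half_le_one_sub_mul_sin_sq {n : ℝ} (hn : n ≤ 1 / 2) (θ : ℝ) :
    1 / 2 ≤ 1 - n * Real.sin θ ^ 2 := by
  nlinarith [Real.sin_sq_le_one θ, sq_nonneg (Real.sin θ)]

lemma continuous_ellipticPi_integrand {n m : ℝ} (hn : n ≤ 1 / 2) (hm : m ≤ 1 / 2) :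
    Continuous fun θ : ℝ =>
      1 / ((1 - n * Real.sin θ ^ 2) * Real.sqrt (1 - m * Real.sin θ ^ 2)) := by
  refine Continuous.div (by fun_prop) (by fun_prop) fun θ => ?_
  have h1 := half_le_one_sub_mul_sin_sq hn θ
  have h2 := half_le_one_sub_mul_sin_sq hm θ
  have h3 : 0 < Real.sqrt (1 - m * Real.sin θ ^ 2) := Real.sqrt_pos.2 (by linarith)
  exact (mul_pos (by linarith) h3).ne'

lemma ellipticPi_nonneg {n m : ℝ} (hn : n ≤ 1 / 2) : 0 ≤ ellipticPi n m := by
  refine integral_nonneg (by positivity) fun θ _ => ?_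
  have := half_le_one_sub_mul_sin_sq hn θ
  exact one_div_nonneg.2 (mul_nonneg (by linarith) (Real.sqrt_nonneg _))

lemma half_le_sqrt_one_sub_mul_sin_sq {m : ℝ} (hm : m ≤ 1 / 2) (θ : ℝ) :
    1 / 2 ≤ Real.sqrt (1 - m * Real.sin θ ^ 2) :=
  Real.le_sqrt_of_sq_le (by linarith [half_le_one_sub_mul_sin_sq hm θ])

lemma ellipticPi_le_two_pi {n m : ℝ} (hn : n ≤ 1 / 2) (hm : m ≤ 1 / 2) :
    ellipticPi n m ≤ 2 * Real.pi := by
  have h : ellipticPi n m ≤ ∫ _ in (0 : ℝ)..(Real.pi / 2), (4 : ℝ) := by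
    refine integral_mono_on (by positivity)
      ((continuous_ellipticPi_integrand hn hm).intervalIntegrable _ _)
      (continuous_const.intervalIntegrable _ _) fun θ _ => ?_
    have h1 := half_le_one_sub_mul_sin_sq hn θ
    have h2 := half_le_sqrt_one_sub_mul_sin_sq hm θ
    rw [div_le_iff₀ (by nlinarith)]
    nlinarith
  rw [intervalIntegral.integral_const, smul_eq_mul] at h
  linarith

lemma le_ellipticPi_neg {N m : ℝ} (hN : 0 ≤ N) (hm0 : 0 ≤ m) (hm : m ≤ 1 / 2) :
    Real.pi / (2 * Real.sqrt (1 + N)) ≤ ellipticPi (-N) m := by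
  rw [← integral_one_div_one_add_mul_sin_sq hN]
  refine integral_mono_on (by positivity)
    ((continuous_one_div_one_add_mul_sin_sq hN).intervalIntegrable _ _)
    ((continuous_ellipticPi_integrand (by linarith) hm).intervalIntegrable _ _) fun θ _ => ?_
  have hpos : 0 < 1 + N * Real.sin θ ^ 2 := by positivity
  have h2 := half_le_sqrt_one_sub_mul_sin_sq hm θ
  have h3 : Real.sqrt (1 - m * Real.sin θ ^ 2) ≤ 1 :=
    Real.sqrt_le_one.2 (by linarith [mul_nonneg hm0 (sq_nonneg (Real.sin θ))])
  rw [neg_mul, sub_neg_eq_add]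
  exact one_div_le_one_div_of_le (mul_pos hpos (by linarith)) (by nlinarith)

lemma ellipticPi_neg_le {N m : ℝ} (hN : 0 < N) (hm0 : 0 ≤ m) (hm : m ≤ 1 / 2) :
    ellipticPi (-N) m ≤ Real.pi / (2 * Real.sqrt (1 + N)) + Real.pi / (2 * N) := by
  have hint := (continuous_one_div_one_add_mul_sin_sq hN.le).intervalIntegrable
    (μ := volume) 0 (Real.pi / 2)
  have hconst : IntervalIntegrable (fun _ : ℝ => 1 / N) volume 0 (Real.pi / 2) :=
    continuous_const.intervalIntegrable _ _
  have h : ellipticPi (-N) m ≤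
      ∫ θ in (0 : ℝ)..(Real.pi / 2), (1 / (1 + N * Real.sin θ ^ 2) + 1 / N) := by
    refine integral_mono_on (by positivity)
      ((continuous_ellipticPi_integrand (by linarith) hm).intervalIntegrable _ _)
      (hint.add hconst) fun θ _ => ?_
    have hpos : 0 < 1 + N * Real.sin θ ^ 2 := by positivity
    have h1 := half_le_one_sub_mul_sin_sq hm θ
    have h2 := half_le_sqrt_one_sub_mul_sin_sq hm θ
    have h4 : 1 - m * Real.sin θ ^ 2 ≤ Real.sqrt (1 - m * Real.sin θ ^ 2) :=
      Real.le_sqrt_of_sq_le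
        (by nlinarith [mul_nonneg hm0 (sq_nonneg (Real.sin θ))])
    have h5 : 1 ≤ (1 + Real.sin θ ^ 2) * Real.sqrt (1 - m * Real.sin θ ^ 2) := by
      nlinarith [Real.sin_sq_le_one θ, sq_nonneg (Real.sin θ),
        mul_nonneg (sub_nonneg.2 hm) (sq_nonneg (Real.sin θ)),
        mul_nonneg (sq_nonneg (Real.sin θ)) (sub_nonneg.2 (Real.sin_sq_le_one θ))]
    rw [neg_mul, sub_neg_eq_add]
    calc 1 / ((1 + N * Real.sin θ ^ 2) * Real.sqrt (1 - m * Real.sin θ ^ 2))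
        ≤ (1 + Real.sin θ ^ 2) / (1 + N * Real.sin θ ^ 2) := by
          rw [div_le_div_iff₀ (mul_pos hpos (by linarith)) hpos]
          nlinarith
      _ ≤ 1 / (1 + N * Real.sin θ ^ 2) + 1 / N := by
          rw [add_div]
          refine add_le_add le_rfl ?_
          rw [div_le_div_iff₀ hpos hN]
          linarith
  rw [intervalIntegral.integral_add hint hconst, integral_one_div_one_add_mul_sin_sq hN.le,
    intervalIntegral.integral_const, smul_eq_mul] at h
  refine h.trans_eq ?_
  field_simp
  ring

lemma abs_progression_angle_sub_le {a b r : ℝ} (hb : 0 < b) (hab : b < a) (har : a < r)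
    (hr : 4 ≤ r) (ha2 : r / 2 ≤ a) (hbr : b ≤ 16 / r ^ 2) (hprod : a * (a + r) * (r - a) = 4) :
    |4 / ((a + r) * Real.sqrt (2 * a + b)) *
        ellipticPi ((a - b) / (a + r)) ((a - b) / (2 * a + b)) -
      4 / ((a - r) * Real.sqrt (2 * a + b)) *
        ellipticPi ((a - b) / (a - r)) ((a - b) / (2 * a + b)) -
      Real.pi * Real.sqrt (a * (a + r) / ((2 * a + b) * (r - b)))| ≤
      16 * Real.pi / r := by
  have hb4 : b ≤ r / 4 := hbr.trans <| by
    rw [div_le_div_iff₀ (by positivity) (by norm_num)]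
    nlinarith [mul_nonneg (sub_nonneg.2 hr) (sq_nonneg r), sq_nonneg (r - 4)]
  have ha : 0 < a := hb.trans hab
  have hra : 0 < r - a := by linarith
  have hS : 1 ≤ Real.sqrt (2 * a + b) := Real.one_le_sqrt.2 (by linarith)
  have hm0 : 0 ≤ (a - b) / (2 * a + b) := div_nonneg (by linarith) (by linarith)
  have hm : (a - b) / (2 * a + b) ≤ 1 / 2 := by
    rw [div_le_div_iff₀ (by linarith) (by norm_num)]; linarith
  have hn : (a - b) / (a + r) ≤ 1 / 2 := by
    rw [div_le_div_iff₀ (by linarith) (by norm_num)]; linarith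
  have hN : 0 < (a - b) / (r - a) := div_pos (by linarith) hra
  have hneg : (a - b) / (a - r) = -((a - b) / (r - a)) := by
    rw [← neg_sub r a, div_neg]
  have hsqrt : 4 / ((r - a) * Real.sqrt (2 * a + b)) *
      (Real.pi / (2 * Real.sqrt (1 + (a - b) / (r - a)))) =
      Real.pi * Real.sqrt (a * (a + r) / ((2 * a + b) * (r - b))) := by
    have h1 : 1 + (a - b) / (r - a) = (r - b) / (r - a) := by field_simp; ring
    have h2 : a * (a + r) / ((2 * a + b) * (r - b)) =
        (2 / ((r - a) * Real.sqrt (2 * a + b) * Real.sqrt ((r - b) / (r - a)))) ^ 2 := by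
      have h3 : 0 < r - b := by linarith
      have h4 : 0 < 2 * a + b := by linarith
      rw [div_pow, mul_pow, mul_pow, Real.sq_sqrt h4.le, Real.sq_sqrt (by positivity)]
      field_simp
      linear_combination hprod
    rw [h1, h2, Real.sqrt_sq (by positivity)]
    field_simp
    norm_num
  have hQl := le_ellipticPi_neg hN.le hm0 hm
  have hQu := ellipticPi_neg_le hN hm0 hm
  have hPl := ellipticPi_nonneg (m := (a - b) / (2 * a + b)) hn
  have hPu := ellipticPi_le_two_pi hn hm
  rw [hneg, ← hsqrt, ← neg_sub r a, neg_mul, div_neg, neg_mul, sub_neg_eq_add]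
  set P := ellipticPi ((a - b) / (a + r)) ((a - b) / (2 * a + b))
  set Q := ellipticPi (-((a - b) / (r - a))) ((a - b) / (2 * a + b))
  set S := Real.sqrt (2 * a + b)
  set J := Real.pi / (2 * Real.sqrt (1 + (a - b) / (r - a)))
  have hpi := Real.pi_pos
  have hfirst : 4 / ((a + r) * S) * P ≤ 8 * Real.pi / r :=
    calc 4 / ((a + r) * S) * P ≤ 4 / r * (2 * Real.pi) := by
          gcongr
          nlinarith
      _ = 8 * Real.pi / r := by ring
  have hsecond : 4 / ((r - a) * S) * (Q - J) ≤ 8 * Real.pi / r :=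
    calc 4 / ((r - a) * S) * (Q - J)
        ≤ 4 / ((r - a) * S) * (Real.pi / (2 * ((a - b) / (r - a)))) := by
          gcongr
          linarith
      _ = 2 * Real.pi / ((a - b) * S) := by
          have : a - b ≠ 0 := by linarith
          field_simp
          norm_num
      _ ≤ 2 * Real.pi / (r / 4) := by
          gcongr
          nlinarith
      _ = 8 * Real.pi / r := by field_simp; norm_num
  have hfirst0 : 0 ≤ 4 / ((a + r) * S) * P := by positivity
  have hsecond0 : 0 ≤ 4 / ((r - a) * S) * (Q - J) :=
    mul_nonneg (by positivity) (by linarith)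
  rw [add_sub_assoc, ← mul_sub, abs_of_nonneg (by positivity)]
  calc _ ≤ 8 * Real.pi / r + 8 * Real.pi / r := add_le_add hfirst hsecond
    _ = 16 * Real.pi / r := by ring

lemma cubic_root_relations {a b c C : ℝ} (hab : b < a) (hb : 0 < b) (hc : c < 0)
    (ha' : a ^ 3 - C * a + 4 = 0) (hb' : b ^ 3 - C * b + 4 = 0) (hc' : c ^ 3 - C * c + 4 = 0) :
    a + b + c = 0 ∧ a ^ 2 + a * b + b ^ 2 = C ∧ a * b * (a + b) = 4 := by
  have h1 : a ^ 2 + a * b + b ^ 2 = C :=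
    mul_left_cancel₀ (sub_ne_zero.2 hab.ne') (by linear_combination ha' - hb')
  have h2 : a ^ 2 + a * c + c ^ 2 = C :=
    mul_left_cancel₀ (sub_ne_zero.2 (hc.trans (hb.trans hab)).ne')
      (by linear_combination ha' - hc')
  refine ⟨mul_left_cancel₀ (sub_ne_zero.2 (hc.trans hb).ne') (by linear_combination h1 - h2),
    h1, ?_⟩
  linear_combination a * h1 - ha'

end

/-- The progression angle `Λ^Θ(C₂)` tends to `π` as `C₂ → +∞`. Here
`a C₂ > b C₂ > 0 > c C₂` are the three distinct real roots of `x³ - C₂x + 4` and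
`r = √C₂`. -/
theorem stmt13 (a b c : ℝ → ℝ)
    (hroots : ∀ C₂ ∈ Set.Ioi (3 * (4 : ℝ) ^ ((1 : ℝ) / 3)),
      a C₂ > b C₂ ∧ b C₂ > 0 ∧ 0 > c C₂ ∧ Real.sqrt C₂ > a C₂ ∧
      (a C₂) ^ 3 - C₂ * a C₂ + 4 = 0 ∧
      (b C₂) ^ 3 - C₂ * b C₂ + 4 = 0 ∧
      (c C₂) ^ 3 - C₂ * c C₂ + 4 = 0) :
    Tendsto (fun C₂ =>
      4 / ((a C₂ + Real.sqrt C₂) * Real.sqrt (a C₂ - c C₂)) *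
        ellipticPi ((a C₂ - b C₂) / (a C₂ + Real.sqrt C₂))
          ((a C₂ - b C₂) / (a C₂ - c C₂)) -
      4 / ((a C₂ - Real.sqrt C₂) * Real.sqrt (a C₂ - c C₂)) *
        ellipticPi ((a C₂ - b C₂) / (a C₂ - Real.sqrt C₂))
          ((a C₂ - b C₂) / (a C₂ - c C₂)))
      atTop (nhds Real.pi) := by
  have hlarge : ∀ᶠ C in atTop, 4 ≤ Real.sqrt C ∧
      C ∈ Set.Ioi (3 * (4 : ℝ) ^ ((1 : ℝ) / 3)) :=
    (Real.tendsto_sqrt_atTop.eventually_ge_atTop 4).and (eventually_gt_atTop _)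
  have hbounds : ∀ᶠ C in atTop, 4 ≤ Real.sqrt C ∧ 0 < b C ∧ b C < a C ∧ a C < Real.sqrt C ∧
      a C + b C + c C = 0 ∧ Real.sqrt C / 2 ≤ a C ∧ b C ≤ 16 / Real.sqrt C ^ 2 ∧
      a C * (a C + Real.sqrt C) * (Real.sqrt C - a C) = 4 := by
    filter_upwards [hlarge] with C hC
    obtain ⟨h4, hC⟩ := hC
    obtain ⟨hab, hb, hc, har, ha', hb', hc'⟩ := hroots C hC
    obtain ⟨hsum, hquad, hprod⟩ := cubic_root_relations hab hb hc ha' hb' hc'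
    have hsq : Real.sqrt C ^ 2 = C := Real.sq_sqrt (by nlinarith)
    have ha2 : Real.sqrt C / 2 ≤ a C := by
      by_contra! h
      nlinarith
    refine ⟨h4, hb, hab, har, hsum, ha2, ?_, ?_⟩
    · rw [le_div_iff₀ (by positivity)]
      calc b C * Real.sqrt C ^ 2 ≤ b C * (2 * a C) ^ 2 := by gcongr; linarith
        _ ≤ 16 := by nlinarith [mul_pos (mul_pos hb hb) (hb.trans hab)]
    · linear_combination a C * hsq - ha'
  have hinv : Tendsto (fun C => (Real.sqrt C)⁻¹) atTop (nhds 0) :=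
    tendsto_inv_atTop_zero.comp Real.tendsto_sqrt_atTop
  have hcube : Tendsto (fun C => 16 * (Real.sqrt C)⁻¹ ^ 3) atTop (nhds 0) := by
    simpa using (hinv.pow 3).const_mul 16
  have hB : Tendsto (fun C => b C / Real.sqrt C) atTop (nhds 0) := by
    refine squeeze_zero' ?_ ?_ hcube
    · filter_upwards [hbounds] with C ⟨_, hb, _⟩
      positivity
    · filter_upwards [hbounds] with C ⟨h4, _, _, _, _, _, hb, _⟩
      have hr : 0 < Real.sqrt C := by linarith
      calc b C / Real.sqrt C ≤ 16 / Real.sqrt C ^ 2 / Real.sqrt C := by gcongr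
        _ = 16 * (Real.sqrt C)⁻¹ ^ 3 := by field_simp
  have hA : Tendsto (fun C => a C / Real.sqrt C) atTop (nhds 1) := by
    have hlow : Tendsto (fun C => 1 - 16 * (Real.sqrt C)⁻¹ ^ 3) atTop (nhds 1) := by
      simpa using hcube.const_sub 1
    refine tendsto_of_tendsto_of_tendsto_of_le_of_le' hlow tendsto_const_nhds ?_ ?_
    · filter_upwards [hbounds] with C ⟨h4, _, _, har, _, ha2, _, hprod⟩
      have hr : 0 < Real.sqrt C := by linarith
      have hdist : (Real.sqrt C - a C) * Real.sqrt C ^ 2 ≤ 16 := by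
        have h : Real.sqrt C ^ 2 ≤ 4 * (a C * (a C + Real.sqrt C)) := by nlinarith
        nlinarith [mul_le_mul_of_nonneg_left h (sub_nonneg.2 har.le)]
      rw [le_div_iff₀ hr]
      have : (1 - 16 * (Real.sqrt C)⁻¹ ^ 3) * Real.sqrt C =
          Real.sqrt C - 16 / Real.sqrt C ^ 2 := by field_simp
      rw [this, sub_le_comm]
      rwa [le_div_iff₀ (by positivity)]
    · filter_upwards [hbounds] with C ⟨h4, _, _, har, _⟩
      exact (div_le_one (by linarith)).2 har.le
  have hmain : Tendsto (fun C => Real.pi * Real.sqrt (a C * (a C + Real.sqrt C) /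
      ((2 * a C + b C) * (Real.sqrt C - b C)))) atTop (nhds Real.pi) := by
    have hratio : Tendsto (fun C => a C / Real.sqrt C * (a C / Real.sqrt C + 1) /
        ((2 * (a C / Real.sqrt C) + b C / Real.sqrt C) * (1 - b C / Real.sqrt C)))
        atTop (nhds (1 * (1 + 1) / ((2 * 1 + 0) * (1 - 0)))) :=
      (hA.mul (hA.add_const 1)).div (((hA.const_mul 2).add hB).mul (hB.const_sub 1)) (by norm_num)
    have hlim := (hratio.sqrt).const_mul Real.pi
    norm_num at hlim
    refine hlim.congr' ?_
    filter_upwards [hbounds] with C ⟨h4, _⟩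
    have hr : Real.sqrt C ≠ 0 := by linarith
    congr 2
    field_simp
  have herr : Tendsto (fun C => 16 * Real.pi / Real.sqrt C) atTop (nhds 0) := by
    simpa [div_eq_mul_inv] using hinv.const_mul (16 * Real.pi)
  have hdiff := squeeze_zero_norm' (f := fun C =>
      4 / ((a C + Real.sqrt C) * Real.sqrt (a C - c C)) *
        ellipticPi ((a C - b C) / (a C + Real.sqrt C)) ((a C - b C) / (a C - c C)) -
      4 / ((a C - Real.sqrt C) * Real.sqrt (a C - c C)) *
        ellipticPi ((a C - b C) / (a C - Real.sqrt C)) ((a C - b C) / (a C - c C)) -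
      Real.pi * Real.sqrt (a C * (a C + Real.sqrt C) /
        ((2 * a C + b C) * (Real.sqrt C - b C)))) (by
    filter_upwards [hbounds] with C ⟨h4, hb, hab, har, hsum, ha2, hbr, hprod⟩
    rw [show a C - c C = 2 * a C + b C by linarith, Real.norm_eq_abs]
    exact abs_progression_angle_sub_le hb hab har h4 ha2 hbr hprod) herr
  simpa using hdiff.add hmain
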